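/- arXiv:2401.14669 — 2 statements merged into one kernel-verified Lean document; each statement's English description precedes it below -/
import Mathlib

section
/- Let p be a probability measure on the product ∏_{t=0}^n X_t of standard Borel spaces. Then p factorizes as a Markov chain if and only if p satisfies the global Markov property: for all pairwise disjoint subsets R, S, T ⊆ {0, …, n} such that for every r ∈ R and t ∈ T there exists s ∈ S with r < s < t or t < s < r, the coordinates (X_r)_{r ∈ R} are conditionally independent of the coordinates (X_t)_{t ∈ T} given the coordinates (X_s)_{s ∈ S} under p. -/
open MeasureTheory ProbabilityTheory
open scoped ENNReal

namespace MarkovChainStmt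

variable {n : ℕ}

/-- The σ-algebra on a product generated by the coordinates in `A`. -/
def coordSigma {X : Fin (n+1) → Type*} [∀ i, MeasurableSpace (X i)]
    (A : Set (Fin (n+1))) : MeasurableSpace (∀ i, X i) :=
  ⨆ i ∈ A, MeasurableSpace.comap (fun ω => ω i) inferInstance

lemma coordSigma_le {X : Fin (n+1) → Type*} [∀ i, MeasurableSpace (X i)]
    (A : Set (Fin (n+1))) : coordSigma (X := X) A ≤ MeasurableSpace.pi := by
  refine iSup_le fun i => iSup_le fun _ => ?_
  exact (measurable_pi_apply i).comap_le

/-- Conditional independence (in the sense of `ProbabilityTheory.CondIndep`) of the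
coordinates in `A` from the coordinates in `B`, given the coordinates in `C`, under `p`. -/
def CondIndepCoords {X : Fin (n+1) → Type*} [∀ i, MeasurableSpace (X i)]
    [∀ i, StandardBorelSpace (X i)]
    (p : Measure (∀ i, X i)) [IsFiniteMeasure p] (C A B : Set (Fin (n+1))) : Prop :=
  CondIndep (coordSigma C) (coordSigma A) (coordSigma B) (coordSigma_le C) p

/-- The backward value function computing the iterated integral
`∫_{S_{t+1}} ⋯ ∫_{S_n} f_n(dx_n|x_{n-1}) ⋯ f_{t+1}(dx_{t+1}|x_t)` as a function of `x_t`. -/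
noncomputable def mcBack {X : Fin (n+1) → Type*} [∀ i, MeasurableSpace (X i)]
    (f : ∀ t : Fin n, Kernel (X t.castSucc) (X t.succ)) (S : ∀ i, Set (X i)) :
    ∀ t : Fin (n+1), X t → ℝ≥0∞ :=
  Fin.reverseInduction (fun _ => 1)
    (fun i ih x => ∫⁻ x' in S i.succ, ih x' ∂ (f i x))

/-- `p` factorizes as a Markov chain: there are an initial distribution `f₀` and Markov
transition kernels `f t` such that for all measurable sets `S i`,
`p (S_0 × ⋯ × S_n) = ∫_{S_0} ⋯ ∫_{S_n} f_n(dx_n|x_{n-1}) ⋯ f_1(dx_1|x_0) f_0(dx_0)`. -/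
def FactorizesAsMarkovChain {X : Fin (n+1) → Type*} [∀ i, MeasurableSpace (X i)]
    (p : Measure (∀ i, X i)) : Prop :=
  ∃ f₀ : Measure (X 0), IsProbabilityMeasure f₀ ∧
    ∃ f : ∀ t : Fin n, Kernel (X t.castSucc) (X t.succ),
      (∀ t, IsMarkovKernel (f t)) ∧
      ∀ S : ∀ i, Set (X i), (∀ i, MeasurableSet (S i)) →
        p (Set.univ.pi S) = ∫⁻ x₀ in S 0, mcBack f S 0 x₀ ∂ f₀

theorem setIntegral_eq_of_generateFrom {Ω : Type*} {m mΩ : MeasurableSpace Ω} (hm : m ≤ mΩ)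
    {μ : Measure Ω} {f g : Ω → ℝ} (hf : Integrable f μ) (hg : Integrable g μ)
    {π : Set (Set Ω)} (hmπ : m = MeasurableSpace.generateFrom π) (hπ : IsPiSystem π)
    (huniv : Set.univ ∈ π) (h : ∀ s ∈ π, ∫ x in s, f x ∂μ = ∫ x in s, g x ∂μ)
    {s : Set Ω} (hs : MeasurableSet[m] s) :
    ∫ x in s, f x ∂μ = ∫ x in s, g x ∂μ := by
  induction s, hs using MeasurableSpace.induction_on_inter hmπ hπ with
  | empty => simp
  | basic t ht => exact h t ht
  | compl t ht ih =>
    rw [setIntegral_compl (hm _ ht) hf, setIntegral_compl (hm _ ht) hg, ih]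
    simpa using h _ huniv
  | iUnion t hd ht ih =>
    rw [integral_iUnion (fun i => hm _ (ht i)) hd hf.integrableOn,
      integral_iUnion (fun i => hm _ (ht i)) hd hg.integrableOn]
    simp_rw [ih]

theorem integrable_indicator_one {Ω : Type*} {mΩ : MeasurableSpace Ω} {μ : Measure Ω}
    [IsFiniteMeasure μ] {s : Set Ω} (hs : MeasurableSet s) :
    Integrable (s.indicator fun _ => (1 : ℝ)) μ :=
  (integrable_const _).indicator hs

theorem generateFrom_inter_eq_sup {Ω : Type*} (m₁ m₂ : MeasurableSpace Ω) :
    m₁ ⊔ m₂ = MeasurableSpace.generateFrom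
      {s | ∃ a c, MeasurableSet[m₁] a ∧ MeasurableSet[m₂] c ∧ s = a ∩ c} := by
  refine le_antisymm (sup_le (fun a ha => ?_) fun c hc => ?_) ?_
  · exact MeasurableSpace.measurableSet_generateFrom ⟨a, Set.univ, ha, .univ, by simp⟩
  · exact MeasurableSpace.measurableSet_generateFrom ⟨Set.univ, c, .univ, hc, by simp⟩
  · refine MeasurableSpace.generateFrom_le ?_
    rintro _ ⟨a, c, ha, hc, rfl⟩
    exact MeasurableSet.inter (le_sup_left (a := m₁) a ha) (le_sup_right (a := m₁) c hc)

theorem isPiSystem_measurable_inter {Ω : Type*} (m₁ m₂ : MeasurableSpace Ω) :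
    IsPiSystem {s | ∃ a c, MeasurableSet[m₁] a ∧ MeasurableSet[m₂] c ∧ s = a ∩ c} := by
  rintro _ ⟨a, c, ha, hc, rfl⟩ _ ⟨a', c', ha', hc', rfl⟩ -
  exact ⟨a ∩ a', c ∩ c', ha.inter ha', hc.inter hc', Set.inter_inter_inter_comm _ _ _ _⟩

/-- Conditional independence of `m₁` and `m₂` given `m'` means that further conditioning on `m₁`
does not change conditional probabilities of events in `m₂`. -/
theorem condIndep_iff_condExp_sup {Ω : Type*} (m' m₁ m₂ : MeasurableSpace Ω)
    {mΩ : MeasurableSpace Ω} [StandardBorelSpace Ω] (hm' : m' ≤ mΩ) (hm₁ : m₁ ≤ mΩ)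
    (hm₂ : m₂ ≤ mΩ) (μ : Measure Ω) [IsFiniteMeasure μ] :
    CondIndep m' m₁ m₂ hm' μ ↔
      ∀ b, MeasurableSet[m₂] b → μ⟦b | m₁ ⊔ m'⟧ =ᵐ[μ] μ⟦b | m'⟧ := by
  rw [condIndep_iff _ _ _ hm' hm₁ hm₂]
  have hsup : m₁ ⊔ m' ≤ mΩ := sup_le hm₁ hm'
  have hmul (a b : Set Ω) : (a ∩ b).indicator (fun _ => (1 : ℝ)) =
      a.indicator (fun _ => 1) * b.indicator fun _ => 1 := by
    ext ω
    by_cases ha : ω ∈ a <;> by_cases hb : ω ∈ b <;> simp [ha, hb]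
  have hbound (a : Set Ω) : ∀ᵐ ω ∂μ, ‖a.indicator (fun _ => (1 : ℝ)) ω‖ ≤ 1 :=
    .of_forall fun ω => by by_cases h : ω ∈ a <;> simp [h]
  constructor
  · intro h b hb
    refine (ae_eq_condExp_of_forall_setIntegral_eq hsup (integrable_indicator_one (hm₂ _ hb))
      (fun _ _ _ => integrable_condExp.integrableOn) (fun s hs _ => ?_)
      (stronglyMeasurable_condExp.mono
        (le_sup_right (a := m₁) (b := m'))).aestronglyMeasurable).symm
    refine setIntegral_eq_of_generateFrom hsup integrable_condExp
      (integrable_indicator_one (hm₂ _ hb)) (generateFrom_inter_eq_sup m₁ m')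
      (isPiSystem_measurable_inter m₁ m') ⟨Set.univ, Set.univ, .univ, .univ, by simp⟩ ?_ hs
    rintro _ ⟨a, c, ha, hc, rfl⟩
    have hpull : μ[a.indicator (fun _ => (1 : ℝ)) * μ⟦b | m'⟧ | m'] =ᵐ[μ]
        μ⟦a | m'⟧ * μ⟦b | m'⟧ := by
      refine condExp_mul_of_stronglyMeasurable_right stronglyMeasurable_condExp ?_
        (integrable_indicator_one (hm₁ _ ha))
      exact integrable_condExp.bdd_mul
        ((stronglyMeasurable_const.indicator (hm₁ _ ha)).aestronglyMeasurable) (hbound a)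
    have hint : Integrable (a.indicator (fun _ => (1 : ℝ)) * μ⟦b | m'⟧) μ :=
      integrable_condExp.bdd_mul
        ((stronglyMeasurable_const.indicator (hm₁ _ ha)).aestronglyMeasurable) (hbound a)
    have hset (g : Ω → ℝ) : ∫ x in a ∩ c, g x ∂μ =
        ∫ x in c, (a.indicator (fun _ => (1 : ℝ)) * g) x ∂μ := by
      have : a.indicator (fun _ => (1 : ℝ)) * g = a.indicator g := by
        ext ω; by_cases h : ω ∈ a <;> simp [h]
      rw [this, setIntegral_indicator (hm₁ _ ha), Set.inter_comm]
    rw [hset, hset, ← hmul, ← setIntegral_condExp hm' hint hc,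
      ← setIntegral_condExp hm' (integrable_indicator_one ((hm₁ _ ha).inter (hm₂ _ hb))) hc]
    exact integral_congr_ae (ae_restrict_of_ae (hpull.trans (h a b ha hb).symm))
  · intro h a b ha hb
    rw [hmul]
    have h1 : μ[a.indicator (fun _ => (1 : ℝ)) * b.indicator (fun _ => 1) | m₁ ⊔ m'] =ᵐ[μ]
        a.indicator (fun _ => 1) * μ⟦b | m'⟧ := by
      refine (condExp_stronglyMeasurable_mul_of_bound hsup
        (stronglyMeasurable_const.indicator (le_sup_left (a := m₁) a ha))
        (integrable_indicator_one (hm₂ _ hb)) 1 (hbound a)).trans ?_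
      exact (Filter.EventuallyEq.refl _ _).mul (h b hb)
    refine (condExp_condExp_of_le le_sup_right hsup).symm.trans ((condExp_congr_ae h1).trans ?_)
    refine condExp_mul_of_stronglyMeasurable_right stronglyMeasurable_condExp ?_
      (integrable_indicator_one (hm₁ _ ha))
    exact integrable_condExp.bdd_mul
      ((stronglyMeasurable_const.indicator (hm₁ _ ha)).aestronglyMeasurable) (hbound a)

section Separation

variable {X : Fin (n+1) → Type*} [∀ i, MeasurableSpace (X i)] {A B C D : Set (Fin (n+1))}

theorem coordSigma_union (A B : Set (Fin (n+1))) :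
    coordSigma (X := X) (A ∪ B) = coordSigma A ⊔ coordSigma B :=
  iSup_union

theorem coordSigma_mono (h : A ⊆ B) : coordSigma (X := X) A ≤ coordSigma B :=
  biSup_mono h

variable [∀ i, StandardBorelSpace (X i)] {p : Measure (∀ i, X i)} [IsFiniteMeasure p]

theorem condIndepCoords_iff :
    CondIndepCoords p C A B ↔ ∀ b, MeasurableSet[coordSigma B] b →
      p⟦b | coordSigma (A ∪ C)⟧ =ᵐ[p] p⟦b | coordSigma C⟧ := by
  rw [CondIndepCoords, condIndep_iff_condExp_sup _ _ _ _ (coordSigma_le A) (coordSigma_le B),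
    coordSigma_union]

theorem CondIndepCoords.symm (h : CondIndepCoords p C A B) : CondIndepCoords p C B A :=
  CondIndep.symm h

theorem CondIndepCoords.mono {A' B' : Set (Fin (n+1))} (h : CondIndepCoords p C A B)
    (hA : A' ⊆ A) (hB : B' ⊆ B) : CondIndepCoords p C A' B' :=
  condIndep_of_condIndep_of_le_right (condIndep_of_condIndep_of_le_left h (coordSigma_mono hA))
    (coordSigma_mono hB)

theorem CondIndepCoords.weak_union (h : CondIndepCoords p C (A ∪ D) B) :
    CondIndepCoords p (D ∪ C) A B := by
  have hD : CondIndepCoords p C D B := h.mono Set.subset_union_right subset_rfl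
  rw [condIndepCoords_iff] at *
  intro b hb
  rw [← Set.union_assoc]
  exact (h b hb).trans (hD b hb).symm

theorem CondIndepCoords.contraction (hD : CondIndepCoords p C D B)
    (h : CondIndepCoords p (D ∪ C) A B) : CondIndepCoords p C (A ∪ D) B := by
  rw [condIndepCoords_iff] at *
  intro b hb
  rw [Set.union_assoc]
  exact (h b hb).trans (hD b hb)

theorem condIndepCoords_empty_left :
    CondIndepCoords p C ∅ B := by
  rw [condIndepCoords_iff]
  simp

/-- Every element of `R` is strictly separated from every element of `T` by an element of `S`. -/
def Separated (S R T : Set (Fin (n+1))) : Prop :=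
  ∀ r ∈ R, ∀ t ∈ T, ∃ s ∈ S, (r < s ∧ s < t) ∨ (t < s ∧ s < r)

theorem Separated.symm {S R T : Set (Fin (n+1))} (h : Separated S R T) : Separated S T R :=
  fun r hr t ht => (h t ht r hr).imp fun _ hs => ⟨hs.1, hs.2.symm⟩

/-- Separation implies conditional independence as soon as, for every time `s`, the past and the
future are conditionally independent given the present. -/
theorem condIndepCoords_of_separated
    (hp : ∀ s, CondIndepCoords p {s} (Set.Ici s) (Set.Iic s)) (S : Finset (Fin (n+1)))
    (R T : Set (Fin (n+1))) (h : Separated (S : Set (Fin (n+1))) R T) :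
    CondIndepCoords p S R T := by
  induction S using Finset.induction_on_max generalizing R T with
  | empty =>
    obtain rfl | ⟨r, hr⟩ := R.eq_empty_or_nonempty
    · exact condIndepCoords_empty_left
    obtain rfl | ⟨t, ht⟩ := T.eq_empty_or_nonempty
    · exact condIndepCoords_empty_left.symm
    simpa using h r hr t ht
  | insert s S hS ih =>
    rw [Finset.coe_insert] at *
    wlog hT : T ⊆ Set.Iic s generalizing R T
    · refine (this T R h.symm fun r hr => ?_).symm
      by_contra hrs
      obtain ⟨t, ht, hts⟩ := Set.not_subset.1 hT
      obtain ⟨u, hu, h⟩ := h r hr t ht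
      have hus : u ≤ s := by
        rcases hu with rfl | hu
        · exact le_rfl
        · exact (hS u hu).le
      simp only [Set.mem_Iic, not_le] at hrs hts
      grind
    set R₁ := R ∩ Set.Iic s
    have hsep : Separated (S : Set (Fin (n+1))) R₁ T := by
      rintro r ⟨hr, hrs⟩ t ht
      obtain ⟨u, hu, hru⟩ := h r hr t ht
      have := hT ht
      simp only [Set.mem_Iic] at hrs this
      refine ⟨u, hu.resolve_left ?_, hru⟩
      grind
    have h₁ : CondIndepCoords p (insert s (S : Set (Fin (n+1)))) R₁ T := by
      rw [← Set.singleton_union]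
      by_cases hsT : Separated (S : Set (Fin (n+1))) {s} T
      · refine (ih (R₁ ∪ {s}) T ?_).weak_union
        rintro r (hr | hr)
        · exact hsep r hr
        · exact hsT r hr
      · refine ((ih (T ∪ {s}) R₁ ?_).weak_union).symm
        rintro t (ht | rfl) r hr
        · exact hsep.symm t ht r hr
        · simp only [Separated, Set.mem_singleton_iff, forall_eq, not_forall] at hsT
          obtain ⟨t', ht', hsT⟩ := hsT
          obtain ⟨u, hu, hru⟩ := hsep r hr t' ht'
          refine ⟨u, hu, ?_⟩
          have := hS u hu
          have hr2 : r ≤ t := hr.2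
          have ht2 : t' ≤ t := hT ht'
          grind
    have h₂ : CondIndepCoords p (R₁ ∪ insert s (S : Set (Fin (n+1)))) (R ∩ Set.Ici s) T := by
      have h := (hp s).mono (A' := R ∩ Set.Ici s) (B' := T ∪ (R₁ ∪ S)) Set.inter_subset_right ?_
      · have h := h.symm.weak_union.symm
        rwa [Set.union_assoc, Set.union_singleton] at h
      · refine Set.union_subset hT (Set.union_subset Set.inter_subset_right fun u hu => ?_)
        exact (hS u hu).le
    refine (h₁.contraction h₂).mono (fun r hr => ?_) subset_rfl
    rcases le_total r s with hrs | hrs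
    · exact Or.inr ⟨hr, hrs⟩
    · exact Or.inl ⟨hr, hrs⟩

end Separation

section Rectangles

variable {X : Fin (n+1) → Type*} [∀ i, MeasurableSpace (X i)] {A : Set (Fin (n+1))}

theorem coordSigma_singleton (t : Fin (n+1)) :
    coordSigma (X := X) {t} = MeasurableSpace.comap (fun ω => ω t) inferInstance := by
  simp [coordSigma]

theorem measurableSet_coordSigma_eval {i : Fin (n+1)} (hi : i ∈ A) {B : Set (X i)}
    (hB : MeasurableSet B) : MeasurableSet[coordSigma A] {ω : ∀ i, X i | ω i ∈ B} :=
  le_iSup₂ (f := fun (i : Fin (n+1)) (_ : i ∈ A) =>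
    MeasurableSpace.comap (fun ω : ∀ i, X i => ω i) inferInstance) i hi _ ⟨B, hB, rfl⟩

/-- Measurable rectangles constraining only the coordinates in `A`. -/
def rectangles (X : Fin (n+1) → Type*) [∀ i, MeasurableSpace (X i)] (A : Set (Fin (n+1))) :
    Set (Set (∀ i, X i)) :=
  {s | ∃ S : ∀ i, Set (X i), (∀ i, MeasurableSet (S i)) ∧ (∀ i ∉ A, S i = Set.univ) ∧
    s = Set.univ.pi S}

theorem isPiSystem_rectangles : IsPiSystem (rectangles X A) := by
  rintro _ ⟨S, hS, hSA, rfl⟩ _ ⟨T, hT, hTA, rfl⟩ -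
  exact ⟨fun i => S i ∩ T i, fun i => (hS i).inter (hT i),
    fun i hi => by simp [hSA i hi, hTA i hi], Set.pi_inter_distrib.symm⟩

theorem coordSigma_eq_generateFrom_rectangles :
    coordSigma (X := X) A = MeasurableSpace.generateFrom (rectangles X A) := by
  classical
  refine le_antisymm (iSup₂_le fun i hi => ?_) (MeasurableSpace.generateFrom_le ?_)
  · rintro _ ⟨B, hB, rfl⟩
    refine MeasurableSpace.measurableSet_generateFrom
      ⟨Function.update (fun _ => Set.univ) i B, fun j => ?_, fun j hj => ?_, ?_⟩
    · obtain rfl | h := eq_or_ne j i <;> simp [*]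
    · have : j ≠ i := fun h => hj (h ▸ hi)
      simp [this]
    · rw [Set.univ_pi_update_univ]
  · rintro _ ⟨S, hS, hSA, rfl⟩
    rw [Set.pi_def]
    refine MeasurableSet.biInter (Set.to_countable _) fun i _ => ?_
    by_cases hi : i ∈ A
    · exact measurableSet_coordSigma_eval hi (hS i)
    · simp [hSA i hi]

end Rectangles

section Path

variable {X : Fin (n+1) → Type*} {S : ∀ i, Set (X i)}

/-- The event that the trajectory lies in `S` up to time `t`. -/
def pathUpTo (S : ∀ i, Set (X i)) (t : Fin (n+1)) : Set (∀ i, X i) :=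
  {ω | ∀ i ≤ t, ω i ∈ S i}

theorem pathUpTo_last : pathUpTo S (Fin.last n) = Set.univ.pi S := by
  ext ω
  simp [pathUpTo, Fin.le_last]

theorem pathUpTo_zero : pathUpTo S 0 = {ω | ω 0 ∈ S 0} := by
  ext ω
  simp [pathUpTo]

theorem pathUpTo_succ (t : Fin n) :
    pathUpTo S t.succ = pathUpTo S t.castSucc ∩ {ω | ω t.succ ∈ S t.succ} := by
  ext ω
  simp only [pathUpTo, Set.mem_inter_iff, Set.mem_ofPred_eq]
  refine ⟨fun h => ⟨fun i hi => h i (hi.trans t.castSucc_lt_succ.le), h _ le_rfl⟩,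
    fun h i hi => ?_⟩
  obtain rfl | hi := hi.eq_or_lt
  · exact h.2
  · exact h.1 i (Fin.le_castSucc_iff.2 hi)

end Path

section Chain

variable {X : Fin (n+1) → Type*} [∀ i, MeasurableSpace (X i)]
  {f : ∀ t : Fin n, Kernel (X t.castSucc) (X t.succ)} {S : ∀ i, Set (X i)}

theorem mcBack_last (x : X (Fin.last n)) : mcBack f S (Fin.last n) x = 1 := by
  simp [mcBack]

theorem mcBack_castSucc (t : Fin n) (x : X t.castSucc) :
    mcBack f S t.castSucc x = ∫⁻ x' in S t.succ, mcBack f S t.succ x' ∂(f t x) := by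
  simp [mcBack]

theorem measurable_mcBack (hS : ∀ i, MeasurableSet (S i)) (t : Fin (n+1)) :
    Measurable (mcBack f S t) := by
  induction t using Fin.reverseInduction with
  | last => simp_rw [funext mcBack_last]; exact measurable_const
  | cast t ih =>
    have : mcBack f S t.castSucc =
        fun x => ∫⁻ x', (S t.succ).indicator (mcBack f S t.succ) x' ∂(f t x) := by
      ext x
      rw [mcBack_castSucc, lintegral_indicator (hS _)]
    rw [this]
    exact (ih.indicator (hS _)).lintegral_kernel

theorem mcBack_le_one [∀ t, IsMarkovKernel (f t)] (t : Fin (n+1)) (x : X t) :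
    mcBack f S t x ≤ 1 := by
  induction t using Fin.reverseInduction with
  | last => rw [mcBack_last]
  | cast t ih =>
    rw [mcBack_castSucc]
    calc ∫⁻ x' in S t.succ, mcBack f S t.succ x' ∂(f t x)
        ≤ ∫⁻ x' in S t.succ, 1 ∂(f t x) := lintegral_mono ih
      _ ≤ 1 := by simpa using prob_le_one

theorem mcBack_congr {S' : ∀ i, Set (X i)} (t : Fin (n+1)) (h : ∀ i, t < i → S i = S' i) :
    mcBack f S t = mcBack f S' t := by
  induction t using Fin.reverseInduction with
  | last => ext x; rw [mcBack_last, mcBack_last]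
  | cast t ih =>
    ext x
    rw [mcBack_castSucc, mcBack_castSucc, h _ t.castSucc_lt_succ,
      ih fun i hi => h i (t.castSucc_lt_succ.trans hi)]

theorem mcBack_eq_one [∀ t, IsMarkovKernel (f t)] (t : Fin (n+1))
    (h : ∀ i, t < i → S i = Set.univ) (x : X t) : mcBack f S t x = 1 := by
  induction t using Fin.reverseInduction with
  | last => rw [mcBack_last]
  | cast t ih =>
    rw [mcBack_castSucc, h _ t.castSucc_lt_succ]
    simp_rw [ih fun i hi => h i (t.castSucc_lt_succ.trans hi)]
    simp

theorem measurableSet_pathUpTo (hS : ∀ i, MeasurableSet (S i)) (t : Fin (n+1)) :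
    MeasurableSet[coordSigma (Set.Iic t)] (pathUpTo S t) := by
  have : pathUpTo S t = ⋂ i ∈ Set.Iic t, {ω | ω i ∈ S i} := by
    ext ω
    simp [pathUpTo]
  rw [this]
  exact MeasurableSet.biInter (Set.to_countable _) fun i hi =>
    measurableSet_coordSigma_eval hi (hS i)

/-- The `t`-th kernel is a transition kernel from the past up to time `t` to time `t + 1`. -/
def IsTransition (p : Measure (∀ i, X i)) (f : ∀ t : Fin n, Kernel (X t.castSucc) (X t.succ))
    (t : Fin n) : Prop :=
  ∀ S : ∀ i, Set (X i), (∀ i, MeasurableSet (S i)) → ∀ B : Set (X t.succ), MeasurableSet B →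
    p (pathUpTo S t.castSucc ∩ {ω | ω t.succ ∈ B}) =
      ∫⁻ ω in pathUpTo S t.castSucc, f t (ω t.castSucc) B ∂p

variable {p : Measure (∀ i, X i)}

theorem IsTransition.lintegral_mcBack {t : Fin n} (h : IsTransition p f t)
    (hS : ∀ i, MeasurableSet (S i)) :
    ∫⁻ ω in pathUpTo S t.castSucc, mcBack f S t.castSucc (ω t.castSucc) ∂p =
      ∫⁻ ω in pathUpTo S t.succ, mcBack f S t.succ (ω t.succ) ∂p := by
  have hev (i : Fin (n+1)) : Measurable fun ω : ∀ i, X i => ω i := measurable_pi_apply i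
  have hmeas : (p.restrict (pathUpTo S t.castSucc)).map (fun ω => ω t.succ) =
      ((p.restrict (pathUpTo S t.castSucc)).map fun ω => ω t.castSucc).bind (f t) := by
    ext B hB
    rw [Measure.bind_apply hB (f t).measurable.aemeasurable,
      lintegral_map ((f t).measurable_coe hB) (hev _), Measure.map_apply (hev _) hB,
      Measure.restrict_apply (hev _ hB), Set.inter_comm, ← h S hS B hB]
    rfl
  have hg := (measurable_mcBack (f := f) hS t.succ).indicator (hS t.succ)
  calc _ = ∫⁻ x, ∫⁻ x', (S t.succ).indicator (mcBack f S t.succ) x' ∂(f t x)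
        ∂((p.restrict (pathUpTo S t.castSucc)).map fun ω => ω t.castSucc) := by
        rw [lintegral_map hg.lintegral_kernel (hev _)]
        simp_rw [mcBack_castSucc, lintegral_indicator (hS _)]
    _ = ∫⁻ ω in pathUpTo S t.castSucc,
        (S t.succ).indicator (mcBack f S t.succ) (ω t.succ) ∂p := by
        rw [← Measure.lintegral_bind (f t).measurable.aemeasurable hg.aemeasurable, ← hmeas,
          lintegral_map hg (hev _)]
    _ = _ := by
        have hm : MeasurableSet {ω : ∀ i, X i | ω t.succ ∈ S t.succ} := hev _ (hS _)
        rw [pathUpTo_succ, Set.inter_comm, ← Measure.restrict_restrict hm,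
          ← lintegral_indicator hm]
        rfl

theorem measure_pi_eq_lintegral_mcBack_zero (h : ∀ t, IsTransition p f t)
    (hS : ∀ i, MeasurableSet (S i)) :
    p (Set.univ.pi S) = ∫⁻ x in S 0, mcBack f S 0 x ∂(p.map fun ω => ω 0) := by
  have key (t : Fin (n+1)) : ∫⁻ ω in pathUpTo S t, mcBack f S t (ω t) ∂p =
      p (Set.univ.pi S) := by
    induction t using Fin.reverseInduction with
    | last => simp_rw [mcBack_last, pathUpTo_last, setLIntegral_one]
    | cast t ih => rw [(h t).lintegral_mcBack hS, ih]
  rw [← key 0, pathUpTo_zero, setLIntegral_map (hS 0) (measurable_mcBack hS 0)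
    (measurable_pi_apply 0)]
  rfl

theorem measure_pi_eq_lintegral_mcBack [∀ t, IsMarkovKernel (f t)] {f₀ : Measure (X 0)}
    (h : ∀ S : ∀ i, Set (X i), (∀ i, MeasurableSet (S i)) →
      p (Set.univ.pi S) = ∫⁻ x₀ in S 0, mcBack f S 0 x₀ ∂ f₀)
    (t : Fin (n+1)) (S : ∀ i, Set (X i)) (hS : ∀ i, MeasurableSet (S i)) :
    p (Set.univ.pi S) = ∫⁻ ω in pathUpTo S t, mcBack f S t (ω t) ∂p := by
  classical
  have hupd {i : Fin (n+1)} {B : Set (X i)} (hB : MeasurableSet B) (j : Fin (n+1)) :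
      MeasurableSet (Function.update (fun j => (Set.univ : Set (X j))) i B j) := by
    obtain rfl | hj := eq_or_ne j i <;> simp [*]
  induction t using Fin.induction generalizing S with
  | zero =>
    have h0 : f₀ = p.map fun ω => ω 0 := by
      ext B hB
      have := h (Function.update (fun _ => Set.univ) 0 B) (hupd hB)
      simp_rw [mcBack_eq_one (f := f) (S := Function.update (fun _ => Set.univ) 0 B) 0
        fun i hi => Function.update_of_ne hi.ne' _ _, setLIntegral_one] at this
      rw [Set.univ_pi_update_univ, Function.update_self] at this
      rw [Measure.map_apply (measurable_pi_apply 0) hB, ← this]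
    rw [h S hS, pathUpTo_zero, h0, setLIntegral_map (hS 0) (measurable_mcBack hS 0)
      (measurable_pi_apply 0)]
    rfl
  | succ t ih =>
    suffices IsTransition p f t by rw [ih S hS, this.lintegral_mcBack hS]
    intro S hS B hB
    let S' : ∀ i, Set (X i) := fun i =>
      if i ≤ t.castSucc then S i else Function.update (fun _ => Set.univ) t.succ B i
    have hS' (i) : MeasurableSet (S' i) := by
      by_cases hi : i ≤ t.castSucc
      · simpa [S', hi] using hS i
      · simpa [S', hi] using hupd hB i
    have hpast : pathUpTo S' t.castSucc = pathUpTo S t.castSucc := by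
      ext ω
      exact forall₂_congr fun i hi => by simp [S', hi]
    have hsucc : S' t.succ = B := by
      simp [S']
    have hfut (i) (hi : t.succ < i) : S' i = Set.univ := by
      have hi' : ¬ i ≤ t.castSucc := (t.castSucc_lt_succ.trans hi).not_ge
      simp [S', hi', hi.ne']
    have hpi : Set.univ.pi S' = pathUpTo S t.castSucc ∩ {ω | ω t.succ ∈ B} := by
      rw [← hpast, ← hsucc, ← pathUpTo_succ]
      ext ω
      simp only [Set.mem_univ_pi, pathUpTo, Set.mem_ofPred_eq]
      refine ⟨fun h i _ => h i, fun h i => ?_⟩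
      rcases le_or_gt i t.succ with hi | hi
      · exact h i hi
      · simp [hfut i hi]
    rw [← hpi, ih S' hS', hpast]
    refine lintegral_congr fun ω => ?_
    rw [mcBack_castSucc, hsucc]
    simp_rw [mcBack_eq_one (f := f) t.succ hfut, setLIntegral_one]

end Chain

section Markov

variable {X : Fin (n+1) → Type*} [∀ i, MeasurableSpace (X i)] [∀ i, StandardBorelSpace (X i)]
  {p : Measure (∀ i, X i)} [IsFiniteMeasure p]
  {f : ∀ t : Fin n, Kernel (X t.castSucc) (X t.succ)}

theorem condIndepCoords_Ici_Iic_of_lintegral_mcBack [∀ t, IsMarkovKernel (f t)]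
    (t : Fin (n+1))
    (h : ∀ S : ∀ i, Set (X i), (∀ i, MeasurableSet (S i)) →
      p (Set.univ.pi S) = ∫⁻ ω in pathUpTo S t, mcBack f S t (ω t) ∂p) :
    CondIndepCoords p {t} (Set.Ici t) (Set.Iic t) := by
  have hle (A : Set (Fin (n+1))) : ∀ s ∈ rectangles X A, MeasurableSet s := by
    rintro _ ⟨S, hS, -, rfl⟩
    exact .univ_pi hS
  have ht : coordSigma (X := X) {t} ≤ MeasurableSpace.pi := coordSigma_le _
  refine CondIndepSets.condIndep (coordSigma_le _) (coordSigma_le _) isPiSystem_rectangles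
    isPiSystem_rectangles coordSigma_eq_generateFrom_rectangles
    coordSigma_eq_generateFrom_rectangles ?_
  rw [condIndepSets_iff _ _ _ _ (hle (Set.Ici t)) (hle (Set.Iic t))]
  rintro b a hb ⟨A, hA, hAt, rfl⟩
  have hbm := hle _ b hb
  obtain ⟨S, hS, hSt, rfl⟩ := hb
  let g : X t → ℝ≥0∞ := (S t).indicator (mcBack f S t)
  let m : (∀ i, X i) → ℝ := fun ω => (g (ω t)).toReal
  have hg : Measurable g := (measurable_mcBack hS t).indicator (hS t)
  have hg1 (x : X t) : g x ≤ 1 := Set.indicator_apply_le' (fun _ => mcBack_le_one t x) (by simp)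
  have hm : StronglyMeasurable[coordSigma {t}] m := by
    rw [coordSigma_singleton]
    exact (hg.ennreal_toReal.comp (comap_measurable fun ω : ∀ i, X i => ω t)).stronglyMeasurable
  have hm1 (ω) : ‖m ω‖ ≤ 1 := by
    simpa [m] using ENNReal.toReal_mono ENNReal.one_ne_top (hg1 (ω t))
  have hmint : Integrable m p :=
    Integrable.of_bound (hm.mono ht).aestronglyMeasurable 1 (.of_forall hm1)
  have hrect (A : ∀ i, Set (X i)) (hA : ∀ i, MeasurableSet (A i))
      (hAt : ∀ i ∉ Set.Iic t, A i = Set.univ) :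
      p.real (Set.univ.pi S ∩ Set.univ.pi A) = ∫ ω in Set.univ.pi A, m ω ∂p := by
    have hpath : pathUpTo (fun i => S i ∩ A i) t =
        {ω | ω t ∈ S t} ∩ Set.univ.pi A := by
      ext ω
      simp only [pathUpTo, Set.mem_inter_iff, Set.mem_ofPred_eq, Set.mem_univ_pi]
      refine ⟨fun h => ⟨(h t le_rfl).1, fun i => ?_⟩, fun h i hi => ⟨?_, h.2 i⟩⟩
      · by_cases hi : i ≤ t
        · exact (h i hi).2
        · simp [hAt i hi]
      · obtain rfl | hi := hi.eq_or_lt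
        · exact h.1
        · simp [hSt i hi.not_ge]
    have hmeas : MeasurableSet {ω : ∀ i, X i | ω t ∈ S t} := measurable_pi_apply t (hS t)
    rw [Measure.real, ← Set.pi_inter_distrib, h _ fun i => (hS i).inter (hA i), hpath,
      mcBack_congr (S' := S) t fun i hi => by simp [hAt i hi.not_ge],
      ← Measure.restrict_restrict hmeas, ← lintegral_indicator hmeas]
    refine (integral_toReal (hg.comp (measurable_pi_apply t)).aemeasurable
      (.of_forall fun ω => (hg1 _).trans_lt ENNReal.one_lt_top)).symm
  have hcond (A : ∀ i, Set (X i)) (hA : ∀ i, MeasurableSet (A i))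
      (hAt : ∀ i ∉ Set.Iic t, A i = Set.univ) :
      p⟦Set.univ.pi S ∩ Set.univ.pi A | coordSigma {t}⟧ =ᵐ[p]
        m * p⟦Set.univ.pi A | coordSigma {t}⟧ := by
    have hAm : MeasurableSet (Set.univ.pi A) := .univ_pi hA
    have hmul : m * (Set.univ.pi A).indicator (fun _ => (1 : ℝ)) = (Set.univ.pi A).indicator m := by
      ext ω
      by_cases hω : ω ∈ Set.univ.pi A <;> simp [hω]
    refine Filter.EventuallyEq.trans ?_ (condExp_stronglyMeasurable_mul_of_bound ht hm
      (integrable_indicator_one hAm) 1 (.of_forall hm1))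
    rw [hmul]
    refine (ae_eq_condExp_of_forall_setIntegral_eq ht
      (integrable_indicator_one (hbm.inter hAm))
      (fun _ _ _ => integrable_condExp.integrableOn) (fun s hs _ => ?_)
      stronglyMeasurable_condExp.aestronglyMeasurable).symm
    have hsm := ht _ hs
    rw [setIntegral_condExp ht (hmint.indicator hAm) hs, setIntegral_indicator hAm,
      setIntegral_indicator (hbm.inter hAm), setIntegral_const, smul_eq_mul, mul_one]
    rw [coordSigma_singleton] at hs
    obtain ⟨C, hC, rfl⟩ := hs
    classical
    have hAC : (fun ω : ∀ i, X i => ω t) ⁻¹' C ∩ Set.univ.pi A =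
        Set.univ.pi fun i => Function.update (fun _ => Set.univ) t C i ∩ A i := by
      rw [Set.pi_inter_distrib, Set.univ_pi_update_univ]
    rw [Set.inter_left_comm, hAC]
    refine (hrect _ (fun i => ?_) fun i hi => ?_).symm
    · refine MeasurableSet.inter ?_ (hA i)
      obtain rfl | hi := eq_or_ne i t <;> simp [*]
    · have : i ≠ t := fun h => hi h.le
      simp [hAt i hi, this]
  have hm_eq : p⟦Set.univ.pi S | coordSigma {t}⟧ =ᵐ[p] m := by
    have := hcond (fun _ => Set.univ) (fun _ => .univ) fun _ _ => rfl
    have hone : p[fun _ : (∀ i, X i) => (1 : ℝ) | coordSigma {t}] = 1 := condExp_const ht 1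
    simpa [hone] using this
  exact (hcond A hA hAt).trans (hm_eq.symm.mul (Filter.EventuallyEq.refl _ _))

theorem isTransition_condDistrib [∀ i, Nonempty (X i)] (t : Fin n)
    (h : CondIndepCoords p {t.castSucc} (Set.Iio t.castSucc) (Set.Ioi t.castSucc)) :
    IsTransition p
      (fun t => condDistrib (fun ω => ω t.succ) (fun ω => ω t.castSucc) p) t := by
  intro S hS B hB
  have hev (i : Fin (n+1)) : Measurable fun ω : ∀ i, X i => ω i := measurable_pi_apply i
  have hpast := measurableSet_pathUpTo hS t.castSucc
  have hBm : MeasurableSet {ω : ∀ i, X i | ω t.succ ∈ B} := hev _ hB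
  have hunion : Set.Iio t.castSucc ∪ {t.castSucc} = Set.Iic t.castSucc := Set.Iio_union_right
  have hcond : (fun ω => (condDistrib (fun ω : ∀ i, X i => ω t.succ) (fun ω => ω t.castSucc) p
      (ω t.castSucc)).real B) =ᵐ[p]
      p⟦{ω | ω t.succ ∈ B} | coordSigma (Set.Iic t.castSucc)⟧ := by
    rw [condIndepCoords_iff, hunion] at h
    refine (condDistrib_ae_eq_condExp (hev _) (hev _) hB).trans ?_
    rw [← coordSigma_singleton]
    exact (h _ (measurableSet_coordSigma_eval t.castSucc_lt_succ hB)).symm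
  have hint := setIntegral_condExp (coordSigma_le _) (integrable_indicator_one (μ := p) hBm) hpast
  rw [← integral_congr_ae (ae_restrict_of_ae hcond), setIntegral_indicator hBm, setIntegral_const,
    smul_eq_mul, mul_one] at hint
  simp_rw [measureReal_def] at hint
  have hκ : Measurable fun ω : ∀ i, X i =>
      condDistrib (fun ω : ∀ i, X i => ω t.succ) (fun ω => ω t.castSucc) p (ω t.castSucc) B :=
    (Kernel.measurable_coe _ hB).comp (hev _)
  rw [integral_toReal hκ.aemeasurable (.of_forall fun ω => measure_lt_top _ _)] at hint
  refine ((ENNReal.toReal_eq_toReal_iff' ?_ (measure_ne_top _ _)).1 hint).symm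
  refine ne_top_of_le_ne_top (measure_ne_top p (pathUpTo S t.castSucc)) ?_
  rw [← setLIntegral_one]
  exact lintegral_mono fun ω => prob_le_one

end Markov

/-- **Equivalence of the Markov chain factorization and the global Markov property**
(Proposition `MarkovChainMarkovProps`, (b) ⇔ (c), instantiated in `BorelStoch`). -/
theorem factorizesAsMarkovChain_iff_globalMarkov
    {X : Fin (n+1) → Type*} [∀ i, MeasurableSpace (X i)] [∀ i, StandardBorelSpace (X i)]
    (p : Measure (∀ i, X i)) [IsProbabilityMeasure p] :
    FactorizesAsMarkovChain p ↔
      (∀ R S T : Set (Fin (n+1)), Disjoint R S → Disjoint R T → Disjoint S T →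
        (∀ r ∈ R, ∀ t ∈ T, ∃ s ∈ S, (r < s ∧ s < t) ∨ (t < s ∧ s < r)) →
        CondIndepCoords p S R T) := by
  constructor
  · rintro ⟨f₀, -, f, hf, h⟩ R S T - - - hsep
    have := condIndepCoords_of_separated (fun s => condIndepCoords_Ici_Iic_of_lintegral_mcBack s
      (measure_pi_eq_lintegral_mcBack h s)) S.toFinite.toFinset R T (by simpa [Separated] using hsep)
    rwa [S.toFinite.coe_toFinset] at this
  · intro h
    have hne : Nonempty (∀ i, X i) := nonempty_of_isProbabilityMeasure p
    have (i : Fin (n+1)) : Nonempty (X i) := hne.map fun ω => ω i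
    refine ⟨p.map fun ω => ω 0,
      Measure.isProbabilityMeasure_map (measurable_pi_apply 0).aemeasurable,
      fun t => condDistrib (fun ω => ω t.succ) (fun ω => ω t.castSucc) p,
      fun t => inferInstance, fun S hS => measure_pi_eq_lintegral_mcBack_zero
        (fun t => isTransition_condDistrib t (h _ _ _ ?_ ?_ ?_ ?_)) hS⟩
    · simp
    · exact Set.disjoint_left.2 fun i hi hi' => lt_asymm (Set.mem_Iio.1 hi) hi'
    · simp
    · exact fun r hr s hs => ⟨_, rfl, Or.inl ⟨hr, hs⟩⟩

end MarkovChainStmt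
end

section
/- Let q be a probability measure on ∏_{t=0}^n (X_t × Y_t) with all X_t, Y_t standard Borel. Then q satisfies the local Markov property — (a) for every 1 ≤ t ≤ n, the coordinate X_t is conditionally independent of the coordinates (X_0, …, X_{t-2}, Y_0, …, Y_{t-1}) given X_{t-1} under q, and (b) for every 0 ≤ t ≤ n, the coordinate Y_t is conditionally independent of all coordinates (X_i)_{i ≠ t} and (Y_j)_{j ≠ t} given X_t under q — if and only if there exist an initial distribution f_0, transition kernels (f_t)_{t=1}^n and observation kernels (g_t)_{t=0}^n such that q equals the associated hidden Markov model measure p. -/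
open MeasureTheory ProbabilityTheory
open scoped ENNReal

namespace HMMStmt

variable {n : ℕ}

/-- The σ-algebra on `∀ i, X i × Y i` generated by the hidden-state coordinates in `A`
together with the observation coordinates in `B`. -/
def coordSigma {X Y : Fin (n+1) → Type*} [∀ i, MeasurableSpace (X i)]
    [∀ i, MeasurableSpace (Y i)] (A B : Set (Fin (n+1))) :
    MeasurableSpace (∀ i, X i × Y i) :=
  (⨆ i ∈ A, MeasurableSpace.comap (fun ω => (ω i).1) inferInstance) ⊔
    (⨆ j ∈ B, MeasurableSpace.comap (fun ω => (ω j).2) inferInstance)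

lemma coordSigma_le {X Y : Fin (n+1) → Type*} [∀ i, MeasurableSpace (X i)]
    [∀ i, MeasurableSpace (Y i)] (A B : Set (Fin (n+1))) :
    coordSigma (X := X) (Y := Y) A B ≤ MeasurableSpace.pi := by
  refine sup_le ?_ ?_
  · exact iSup_le fun i => iSup_le fun _ => ((measurable_pi_apply i).fst).comap_le
  · exact iSup_le fun j => iSup_le fun _ => ((measurable_pi_apply j).snd).comap_le

/-- Conditional independence (in the sense of `ProbabilityTheory.CondIndep`) under `p` of
the coordinates `((X_r)_{r ∈ A}, (Y_u)_{u ∈ A'})` from `((X_t)_{t ∈ B}, (Y_w)_{w ∈ B'})`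
given `((X_s)_{s ∈ C}, (Y_v)_{v ∈ C'})`. -/
def CondIndepCoords {X Y : Fin (n+1) → Type*} [∀ i, MeasurableSpace (X i)]
    [∀ i, MeasurableSpace (Y i)] [∀ i, StandardBorelSpace (X i)]
    [∀ i, StandardBorelSpace (Y i)]
    (p : Measure (∀ i, X i × Y i)) [IsFiniteMeasure p]
    (C C' A A' B B' : Set (Fin (n+1))) : Prop :=
  CondIndep (coordSigma C C') (coordSigma A A') (coordSigma B B') (coordSigma_le C C') p

/-- Backward value function computing the iterated integral
`∫_{S_{t+1}} g_{t+1}(T_{t+1}|x_{t+1}) ⋯ (∫_{S_n} g_n(T_n|x_n) f_n(dx_n|x_{n-1})) ⋯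
f_{t+1}(dx_{t+1}|x_t)` times `g_t(T_t | x_t)`, as a function of `x_t`. -/
noncomputable def hmmBack {X Y : Fin (n+1) → Type*} [∀ i, MeasurableSpace (X i)]
    [∀ i, MeasurableSpace (Y i)]
    (f : ∀ t : Fin n, Kernel (X t.castSucc) (X t.succ))
    (g : ∀ t : Fin (n+1), Kernel (X t) (Y t))
    (S : ∀ i, Set (X i)) (T : ∀ i, Set (Y i)) : ∀ t : Fin (n+1), X t → ℝ≥0∞ :=
  Fin.reverseInduction (fun x => g (Fin.last n) x (T (Fin.last n)))
    (fun i ih x => g i.castSucc x (T i.castSucc) * ∫⁻ x' in S i.succ, ih x' ∂ (f i x))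

/-- `p` is the hidden Markov model measure associated with the initial distribution `f₀`,
the transition kernels `f` and the observation kernels `g`: for all measurable sets,
`p (∏ t, S_t × T_t) = ∫_{S_0} ⋯ ∫_{S_n} ∏_t g_t(T_t|x_t) f_n(dx_n|x_{n-1}) ⋯ f_0(dx_0)`. -/
def IsHMM {X Y : Fin (n+1) → Type*} [∀ i, MeasurableSpace (X i)]
    [∀ i, MeasurableSpace (Y i)] (p : Measure (∀ i, X i × Y i))
    (f₀ : Measure (X 0)) (f : ∀ t : Fin n, Kernel (X t.castSucc) (X t.succ))
    (g : ∀ t : Fin (n+1), Kernel (X t) (Y t)) : Prop :=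
  ∀ (S : ∀ i, Set (X i)) (T : ∀ i, Set (Y i)),
    (∀ i, MeasurableSet (S i)) → (∀ i, MeasurableSet (T i)) →
      p (Set.univ.pi fun i => (S i) ×ˢ (T i)) = ∫⁻ x₀ in S 0, hmmBack f g S T 0 x₀ ∂ f₀

theorem mul_condExp_indicator_ae_eq_iff {Ω : Type*} {m mΩ : MeasurableSpace Ω} (hm : m ≤ mΩ)
    {μ : Measure Ω} [IsFiniteMeasure μ] {A D : Set Ω} (hA : MeasurableSet A)
    (hD : MeasurableSet D) {k : Ω → ℝ} (hk : StronglyMeasurable[m] k) {c : ℝ}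
    (hkc : ∀ ω, ‖k ω‖ ≤ c) :
    (k * μ⟦D | m⟧ =ᵐ[μ] μ⟦A ∩ D | m⟧) ↔
      ∀ C, MeasurableSet[m] C → ∫ ω in C ∩ D, k ω ∂μ = μ.real (C ∩ (A ∩ D)) := by
  have hint : Integrable k μ :=
    Integrable.of_bound (hk.mono hm).aestronglyMeasurable c (.of_forall hkc)
  have hind : ∀ s : Set Ω, MeasurableSet s → Integrable (s.indicator fun _ => (1 : ℝ)) μ :=
    fun s hs => (integrable_const _).indicator hs
  have hmul : k * D.indicator (fun _ => (1 : ℝ)) = D.indicator k := by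
    ext ω
    by_cases h : ω ∈ D <;> simp [h]
  have hpull : μ[D.indicator k | m] =ᵐ[μ] k * μ⟦D | m⟧ := by
    have := condExp_stronglyMeasurable_mul_of_bound hm hk (hind D hD) c (.of_forall hkc)
    rwa [hmul] at this
  have hleft : ∀ C, MeasurableSet[m] C →
      ∫ ω in C, (k * μ⟦D | m⟧) ω ∂μ = ∫ ω in C ∩ D, k ω ∂μ := by
    intro C hC
    rw [← setIntegral_congr_ae (hm C hC) (hpull.mono fun _ h _ => h),
      setIntegral_condExp hm (hint.indicator hD) hC, setIntegral_indicator hD]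
  have hright : ∀ C, MeasurableSet[m] C →
      ∫ ω in C, (A ∩ D).indicator (fun _ => (1 : ℝ)) ω ∂μ = μ.real (C ∩ (A ∩ D)) := by
    intro C hC
    rw [setIntegral_indicator (hA.inter hD)]
    simp
  constructor
  · intro h C hC
    rw [← hleft C hC, setIntegral_congr_ae (hm C hC) (h.mono fun _ h _ => h),
      setIntegral_condExp hm (hind _ (hA.inter hD)) hC, hright C hC]
  · intro h
    have hi : Integrable (k * μ⟦D | m⟧) μ := integrable_condExp.congr hpull
    exact ae_eq_condExp_of_forall_setIntegral_eq hm (hind _ (hA.inter hD))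
      (fun C _ _ => hi.integrableOn)
      (fun C hC _ => by rw [hleft C hC, h C hC, hright C hC])
      (hk.mul stronglyMeasurable_condExp).aestronglyMeasurable

theorem setLIntegral_eq_iff_setIntegral {Ω E F : Type*} [MeasurableSpace Ω] [MeasurableSpace E]
    [MeasurableSpace F] {μ : Measure Ω} [IsFiniteMeasure μ] (κ : Kernel E F) [IsMarkovKernel κ]
    {X : Ω → E} (hX : Measurable X) {A : Set F} (hA : MeasurableSet A) (s t : Set Ω) :
    ∫⁻ ω in s, κ (X ω) A ∂μ = μ t ↔ ∫ ω in s, (κ (X ω)).real A ∂μ = μ.real t := by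
  have hmeas : Measurable fun ω => κ (X ω) A := (κ.measurable_coe hA).comp hX
  have hle : ∫⁻ ω in s, κ (X ω) A ∂μ ≠ ∞ := by
    refine ((lintegral_mono (g := fun _ => 1) fun ω => prob_le_one).trans_lt ?_).ne
    simp
  have : ∫ ω in s, (κ (X ω)).real A ∂μ = (∫⁻ ω in s, κ (X ω) A ∂μ).toReal :=
    integral_toReal hmeas.aemeasurable (.of_forall fun _ => measure_lt_top _ _)
  rw [this, measureReal_def, ENNReal.toReal_eq_toReal_iff' hle (measure_ne_top _ _)]

section

variable {Ω E F : Type*} {m₂ : MeasurableSpace Ω} [mΩ : MeasurableSpace Ω]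
  [StandardBorelSpace Ω] [mE : MeasurableSpace E] [mF : MeasurableSpace F] {μ : Measure Ω} [IsFiniteMeasure μ] {X : Ω → E} {Z : Ω → F}

/-- Disintegration along `X` of a coordinate `Z` remains valid on events conditionally independent
of `Z` given `X`. -/
theorem setLIntegral_eq_of_condIndep [StandardBorelSpace F] [Nonempty F]
    (hX : Measurable X) (hZ : Measurable Z)
    (hm₂ : m₂ ≤ mΩ)
    (h : CondIndep (mE.comap X) (mF.comap Z) m₂ hX.comap_le μ)
    {D : Set Ω} (hD : MeasurableSet[m₂] D) {φ : E × F → ℝ≥0∞} (hφ : Measurable φ) :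
    ∫⁻ ω in D, φ (X ω, Z ω) ∂μ
      = ∫⁻ ω in D, ∫⁻ z, φ (X ω, z) ∂(condDistrib Z X μ (X ω)) ∂μ := by
  have hrect : (μ.restrict D).map (fun ω => (X ω, Z ω))
      = (μ.restrict D).map X ⊗ₘ condDistrib Z X μ := by
    refine Measure.ext_prod fun {C A} hC hA => ?_
    rw [Measure.map_apply (hX.prodMk hZ) (hC.prod hA), Measure.compProd_apply_prod hC hA,
      setLIntegral_map hC (Kernel.measurable_coe _ hA) hX,
      Measure.restrict_restrict (hX hC),
      Measure.restrict_apply ((hX.prodMk hZ) (hC.prod hA))]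
    symm
    rw [setLIntegral_eq_iff_setIntegral _ hX hA]
    have hk := condDistrib_ae_eq_condExp (μ := μ) hX hZ hA
    have hci := (condIndep_iff _ _ _ _ hZ.comap_le hm₂ μ).1 h (Z ⁻¹' A) D ⟨A, hA, rfl⟩ hD
    have hae := (hk.mul (Filter.EventuallyEq.refl _ (μ⟦D | mE.comap X⟧))).trans hci.symm
    have hkm : StronglyMeasurable[mE.comap X] fun ω => (condDistrib Z X μ (X ω)).real A :=
      (((Kernel.measurable_coe _ hA).comp (comap_measurable X)).ennreal_toReal).stronglyMeasurable
    have := (mul_condExp_indicator_ae_eq_iff hX.comap_le (hZ hA) (hm₂ D hD) hkm (c := 1)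
      (fun ω => by simp [abs_of_nonneg])).1 hae (X ⁻¹' C) ⟨C, hC, rfl⟩
    rw [this]
    congr 1
    ext ω
    simp [and_assoc]
  have := congrArg (fun ν => ∫⁻ x, φ x ∂ν) hrect
  rwa [lintegral_map hφ (hX.prodMk hZ), Measure.lintegral_compProd hφ,
    lintegral_map hφ.lintegral_kernel_prod_right' hX] at this

/-- If `κ` disintegrates `Z` along `X` on every event of a generating π-system, then that π-system
generates a σ-algebra conditionally independent of `Z` given `X`. -/
theorem condIndep_of_setLIntegral_eq (hX : Measurable X) (hZ : Measurable Z)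
    (κ : Kernel E F) [IsMarkovKernel κ] {P : Set (Set Ω)} (hPm : ∀ D ∈ P, MeasurableSet D)
    (hP : IsPiSystem P) (hPuniv : Set.univ ∈ P)
    (h : ∀ C A D, MeasurableSet C → MeasurableSet A → D ∈ P →
      ∫⁻ ω in X ⁻¹' C ∩ D, κ (X ω) A ∂μ = μ (X ⁻¹' C ∩ (Z ⁻¹' A ∩ D))) :
    CondIndep (mE.comap X) (mF.comap Z) (MeasurableSpace.generateFrom P) hX.comap_le μ := by
  have hae : ∀ A D, MeasurableSet A → D ∈ P →
      (fun ω => (κ (X ω)).real A) * μ⟦D | mE.comap X⟧ =ᵐ[μ] μ⟦Z ⁻¹' A ∩ D | mE.comap X⟧ := by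
    intro A D hA hD
    have hkm : StronglyMeasurable[mE.comap X] fun ω => (κ (X ω)).real A :=
      (((Kernel.measurable_coe _ hA).comp (comap_measurable X)).ennreal_toReal).stronglyMeasurable
    refine (mul_condExp_indicator_ae_eq_iff hX.comap_le (hZ hA) (hPm D hD) hkm (c := 1)
      (fun ω => by simp [abs_of_nonneg])).2 ?_
    rintro _ ⟨C, hC, rfl⟩
    exact (setLIntegral_eq_iff_setIntegral κ hX hA _ _).1 (h C A D hC hA hD)
  refine CondIndepSets.condIndep (p1 := {s | MeasurableSet[mF.comap Z] s}) (p2 := P) hZ.comap_le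
    (MeasurableSpace.generateFrom_le hPm) (@MeasurableSpace.isPiSystem_measurableSet _ (mF.comap Z)) hP
    (@MeasurableSpace.generateFrom_measurableSet _ (mF.comap Z)).symm rfl ?_
  rw [condIndepSets_iff _ _ {s | MeasurableSet[mF.comap Z] s} P (fun s hs => hZ.comap_le s hs) hPm]
  rintro _ D ⟨A, hA, rfl⟩ hD
  have huniv := hae A Set.univ hA hPuniv
  have h1 : (μ⟦Set.univ | mE.comap X⟧) = fun _ => (1 : ℝ) := by
    rw [Set.indicator_univ]
    exact condExp_const hX.comap_le 1
  rw [h1, Set.inter_univ] at huniv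
  filter_upwards [huniv, hae A D hA hD] with ω h₁ h₂
  simp only [Pi.mul_apply, mul_one] at h₁ h₂ ⊢
  rw [← h₂, ← h₁]

end

section
variable {X Y : Fin (n+1) → Type*}

/-- The measurable rectangle of paths with hidden states in `S` and observations in `T`. -/
def rect (S : ∀ i, Set (X i)) (T : ∀ i, Set (Y i)) : Set (∀ i, X i × Y i) :=
  Set.univ.pi fun i => S i ×ˢ T i

theorem mem_rect {S : ∀ i, Set (X i)} {T : ∀ i, Set (Y i)} {ω : ∀ i, X i × Y i} :
    ω ∈ rect S T ↔ ∀ i, (ω i).1 ∈ S i ∧ (ω i).2 ∈ T i := by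
  simp [rect, Set.mem_pi]

theorem rect_eq_state_inter {S S' : ∀ i, Set (X i)} {T : ∀ i, Set (Y i)} {t : Fin (n+1)}
    (h : ∀ i, i ≠ t → S' i = S i) (ht : S t = Set.univ) :
    rect S' T = (fun ω => (ω t).1) ⁻¹' (S' t) ∩ rect S T := by
  ext ω
  simp only [Set.mem_inter_iff, mem_rect, Set.mem_preimage]
  refine ⟨fun hω => ⟨(hω t).1, fun i => ?_⟩, fun ⟨h₁, hω⟩ i => ?_⟩
  · by_cases hi : i = t
    · subst hi; simpa [ht] using (hω i).2
    · exact h i hi ▸ hω i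
  · by_cases hi : i = t
    · subst hi; exact ⟨h₁, (hω i).2⟩
    · exact (h i hi).symm ▸ hω i

theorem rect_eq_obs_inter {S : ∀ i, Set (X i)} {T T' : ∀ i, Set (Y i)} {t : Fin (n+1)}
    (h : ∀ i, i ≠ t → T' i = T i) (ht : T t = Set.univ) :
    rect S T' = (fun ω => (ω t).2) ⁻¹' (T' t) ∩ rect S T := by
  ext ω
  simp only [Set.mem_inter_iff, mem_rect, Set.mem_preimage]
  refine ⟨fun hω => ⟨(hω t).2, fun i => ?_⟩, fun ⟨h₁, hω⟩ i => ?_⟩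
  · by_cases hi : i = t
    · subst hi; simpa [ht] using (hω i).1
    · exact h i hi ▸ hω i
  · by_cases hi : i = t
    · subst hi; exact ⟨(hω i).1, h₁⟩
    · exact (h i hi).symm ▸ hω i

variable [∀ i, MeasurableSpace (X i)] [∀ i, MeasurableSpace (Y i)]

theorem measurableSet_rect {S : ∀ i, Set (X i)} {T : ∀ i, Set (Y i)}
    (hS : ∀ i, MeasurableSet (S i)) (hT : ∀ i, MeasurableSet (T i)) :
    MeasurableSet (rect S T) :=
  .univ_pi fun i => (hS i).prod (hT i)

theorem measurable_state (t : Fin (n+1)) : Measurable fun ω : ∀ i, X i × Y i => (ω t).1 :=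
  (measurable_pi_apply t).fst

theorem measurable_obs (t : Fin (n+1)) : Measurable fun ω : ∀ i, X i × Y i => (ω t).2 :=
  (measurable_pi_apply t).snd

/-- Measurable rectangles constraining only the states in `A` and the observations in `B`. -/
def coordRects (A B : Set (Fin (n+1))) : Set (Set (∀ i, X i × Y i)) :=
  {s | ∃ (S : ∀ i, Set (X i)) (T : ∀ i, Set (Y i)), (∀ i, MeasurableSet (S i)) ∧
    (∀ i, MeasurableSet (T i)) ∧ (∀ i, i ∉ A → S i = Set.univ) ∧ (∀ i, i ∉ B → T i = Set.univ) ∧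
    rect S T = s}

theorem univ_mem_coordRects (A B : Set (Fin (n+1))) :
    Set.univ ∈ coordRects (X := X) (Y := Y) A B :=
  ⟨fun _ => Set.univ, fun _ => Set.univ, by simp, by simp, by simp, by simp, by simp [rect]⟩

theorem isPiSystem_coordRects (A B : Set (Fin (n+1))) :
    IsPiSystem (coordRects (X := X) (Y := Y) A B) := by
  rintro _ ⟨S, T, hS, hT, hA, hB, rfl⟩ _ ⟨S', T', hS', hT', hA', hB', rfl⟩ -
  refine ⟨fun i => S i ∩ S' i, fun i => T i ∩ T' i, fun i => (hS i).inter (hS' i),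
    fun i => (hT i).inter (hT' i), fun i hi => by simp [hA i hi, hA' i hi],
    fun i hi => by simp [hB i hi, hB' i hi], ?_⟩
  ext ω
  simp only [mem_rect, Set.mem_inter_iff]
  grind

theorem measurableSet_of_mem_coordRects {A B : Set (Fin (n+1))} {s : Set (∀ i, X i × Y i)}
    (hs : s ∈ coordRects A B) : MeasurableSet s := by
  obtain ⟨S, T, hS, hT, -, -, rfl⟩ := hs
  exact measurableSet_rect hS hT

theorem generateFrom_coordRects (A B : Set (Fin (n+1))) :
    MeasurableSpace.generateFrom (coordRects A B) = coordSigma (X := X) (Y := Y) A B := by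
  refine le_antisymm (MeasurableSpace.generateFrom_le ?_) (sup_le ?_ ?_)
  · rintro _ ⟨S, T, hS, hT, hA, hB, rfl⟩
    have heq : rect S T = ⋂ i, ((fun ω => (ω i).1) ⁻¹' (S i) ∩ (fun ω => (ω i).2) ⁻¹' (T i)) := by
      ext ω
      simp [mem_rect]
    rw [heq]
    refine @MeasurableSet.iInter _ _ (coordSigma A B) _ _ fun i =>
      @MeasurableSet.inter _ (coordSigma A B) _ _ ?_ ?_
    · by_cases hi : i ∈ A
      · have hle : MeasurableSpace.comap (fun ω : ∀ i, X i × Y i => (ω i).1) inferInstance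
            ≤ coordSigma A B := le_sup_of_le_left (le_iSup₂_of_le i hi le_rfl)
        exact hle _ ⟨S i, hS i, rfl⟩
      · rw [hA i hi]
        exact @MeasurableSet.univ _ (coordSigma A B)
    · by_cases hi : i ∈ B
      · have hle : MeasurableSpace.comap (fun ω : ∀ i, X i × Y i => (ω i).2) inferInstance
            ≤ coordSigma A B := le_sup_of_le_right (le_iSup₂_of_le i hi le_rfl)
        exact hle _ ⟨T i, hT i, rfl⟩
      · rw [hB i hi]
        exact @MeasurableSet.univ _ (coordSigma A B)
  · refine iSup₂_le fun i hi => ?_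
    rintro _ ⟨C, hC, rfl⟩
    refine MeasurableSpace.measurableSet_generateFrom
      ⟨Function.update (fun _ => Set.univ) i C, fun _ => Set.univ, fun j => ?_, by simp,
        fun j hj => ?_, by simp, ?_⟩
    · by_cases h : j = i
      · subst h; simpa
      · simp [h]
    · rw [Function.update_of_ne (by rintro rfl; exact hj hi)]
    · rw [rect_eq_state_inter (S := fun _ => Set.univ) (t := i) (fun j hj => by simp [hj]) rfl]
      simp [rect]
  · refine iSup₂_le fun i hi => ?_
    rintro _ ⟨C, hC, rfl⟩
    refine MeasurableSpace.measurableSet_generateFrom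
      ⟨fun _ => Set.univ, Function.update (fun _ => Set.univ) i C, by simp, fun j => ?_, by simp,
        fun j hj => ?_, ?_⟩
    · by_cases h : j = i
      · subst h; simpa
      · simp [h]
    · rw [Function.update_of_ne (by rintro rfl; exact hj hi)]
    · rw [rect_eq_obs_inter (T := fun _ => Set.univ) (t := i) (fun j hj => by simp [hj]) rfl]
      simp [rect]

theorem measurableSet_rect_coordSigma {A B : Set (Fin (n+1))} {S : ∀ i, Set (X i)}
    {T : ∀ i, Set (Y i)} (hS : ∀ i, MeasurableSet (S i)) (hT : ∀ i, MeasurableSet (T i))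
    (hA : ∀ i, i ∉ A → S i = Set.univ) (hB : ∀ i, i ∉ B → T i = Set.univ) :
    MeasurableSet[coordSigma A B] (rect S T) := by
  rw [← generateFrom_coordRects]
  exact MeasurableSpace.measurableSet_generateFrom ⟨S, T, hS, hT, hA, hB, rfl⟩

theorem coordSigma_singleton_empty (t : Fin (n+1)) :
    coordSigma (X := X) (Y := Y) {t} ∅
      = MeasurableSpace.comap (fun ω => (ω t).1) inferInstance := by
  simp [coordSigma]

theorem coordSigma_empty_singleton (t : Fin (n+1)) :
    coordSigma (X := X) (Y := Y) ∅ {t}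
      = MeasurableSpace.comap (fun ω => (ω t).2) inferInstance := by
  simp [coordSigma]

section
variable (f₀ : Measure (X 0)) (f : ∀ t : Fin n, Kernel (X t.castSucc) (X t.succ))
  (g : ∀ t : Fin (n+1), Kernel (X t) (Y t)) (S : ∀ i, Set (X i)) (T : ∀ i, Set (Y i))

theorem hmmBack_last :
    hmmBack f g S T (Fin.last n) = fun x => g (Fin.last n) x (T (Fin.last n)) :=
  Fin.reverseInduction_last

theorem hmmBack_castSucc (i : Fin n) :
    hmmBack f g S T i.castSucc
      = fun x => g i.castSucc x (T i.castSucc) *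
          ∫⁻ x' in S i.succ, hmmBack f g S T i.succ x' ∂(f i x) :=
  Fin.reverseInduction_castSucc i

/-- The forward measure: the law of `X t` weighted by the constraints at the times before `t`. -/
noncomputable def hmmFwd : ∀ t : Fin (n+1), Measure (X t) :=
  Fin.induction f₀ fun i ν =>
    ((ν.restrict (S i.castSucc)).withDensity fun x => g i.castSucc x (T i.castSucc)).bind (f i)

theorem hmmFwd_zero : hmmFwd f₀ f g S T 0 = f₀ := rfl

theorem hmmFwd_succ (i : Fin n) :
    hmmFwd f₀ f g S T i.succ
      = (((hmmFwd f₀ f g S T i.castSucc).restrict (S i.castSucc)).withDensity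
          fun x => g i.castSucc x (T i.castSucc)).bind (f i) :=
  Fin.induction_succ _ _ i

variable {S T}

theorem measurable_setLIntegral_kernel {E F : Type*} [MeasurableSpace E] [MeasurableSpace F]
    (κ : Kernel E F) {s : Set F} (hs : MeasurableSet s) {φ : F → ℝ≥0∞} (hφ : Measurable φ) :
    Measurable fun x => ∫⁻ z in s, φ z ∂(κ x) := by
  simp_rw [← lintegral_indicator hs]
  exact (hφ.indicator hs).lintegral_kernel

theorem measurable_hmmBack (hS : ∀ i, MeasurableSet (S i)) (hT : ∀ i, MeasurableSet (T i))
    (t : Fin (n+1)) : Measurable (hmmBack f g S T t) := by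
  induction t using Fin.reverseInduction with
  | last =>
    rw [hmmBack_last]
    exact Kernel.measurable_coe _ (hT _)
  | cast i ih =>
    rw [hmmBack_castSucc]
    exact (Kernel.measurable_coe _ (hT _)).mul (measurable_setLIntegral_kernel (f i) (hS _) ih)

theorem hmmBack_congr {S' : ∀ i, Set (X i)} {T' : ∀ i, Set (Y i)} (t : Fin (n+1))
    (hS : ∀ i, t < i → S i = S' i) (hT : ∀ i, t ≤ i → T i = T' i) :
    hmmBack f g S T t = hmmBack f g S' T' t := by
  induction t using Fin.reverseInduction with
  | last => rw [hmmBack_last, hmmBack_last, hT _ le_rfl]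
  | cast i ih =>
    rw [hmmBack_castSucc, hmmBack_castSucc, hT _ le_rfl, hS i.succ i.castSucc_lt_succ,
      ih (fun j hj => hS j (i.castSucc_lt_succ.trans hj))
        (fun j hj => hT j (i.castSucc_lt_succ.le.trans hj))]

theorem hmmBack_eq_one [∀ t, IsMarkovKernel (f t)] [∀ t, IsMarkovKernel (g t)] (t : Fin (n+1))
    (hS : ∀ i, t < i → S i = Set.univ) (hT : ∀ i, t ≤ i → T i = Set.univ) :
    hmmBack f g S T t = 1 := by
  induction t using Fin.reverseInduction with
  | last =>
    rw [hmmBack_last, hT _ le_rfl]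
    ext x
    simp
  | cast i ih =>
    rw [hmmBack_castSucc, hT _ le_rfl, hS i.succ i.castSucc_lt_succ,
      ih (fun j hj => hS j (i.castSucc_lt_succ.trans hj))
        (fun j hj => hT j (i.castSucc_lt_succ.le.trans hj))]
    ext x
    simp

/-- The observation weight at the current time factors out of the backward value function. -/
theorem hmmBack_eq_mul_update [∀ t, IsMarkovKernel (g t)] (t : Fin (n+1)) (x : X t) :
    hmmBack f g S T t x
      = hmmBack f g S (Function.update T t Set.univ) t x * g t x (T t) := by
  induction t using Fin.reverseInduction with
  | last => simp [hmmBack_last]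
  | cast i _ =>
    rw [hmmBack_castSucc, hmmBack_castSucc, hmmBack_congr f g (S := S) (S' := S) (T := T)
      (T' := Function.update T i.castSucc Set.univ) i.succ (fun _ _ => rfl)
      (fun j hj => by
        rw [Function.update_of_ne (i.castSucc_lt_succ.trans_le hj).ne'])]
    simp [mul_comm]

theorem hmmFwd_congr {S' : ∀ i, Set (X i)} {T' : ∀ i, Set (Y i)} (t : Fin (n+1))
    (hS : ∀ i, i < t → S i = S' i) (hT : ∀ i, i < t → T i = T' i) :
    hmmFwd f₀ f g S T t = hmmFwd f₀ f g S' T' t := by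
  induction t using Fin.induction with
  | zero => rw [hmmFwd_zero, hmmFwd_zero]
  | succ i ih =>
    rw [hmmFwd_succ, hmmFwd_succ, hT _ i.castSucc_lt_succ, hS _ i.castSucc_lt_succ,
      ih (fun j hj => hS j (hj.trans i.castSucc_lt_succ))
        (fun j hj => hT j (hj.trans i.castSucc_lt_succ))]

theorem setLIntegral_hmmBack_hmmFwd (hS : ∀ i, MeasurableSet (S i))
    (hT : ∀ i, MeasurableSet (T i)) (t : Fin (n+1)) :
    ∫⁻ x in S t, hmmBack f g S T t x ∂(hmmFwd f₀ f g S T t)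
      = ∫⁻ x in S 0, hmmBack f g S T 0 x ∂f₀ := by
  induction t using Fin.induction with
  | zero => rfl
  | succ i ih =>
    rw [← ih, hmmFwd_succ, hmmBack_castSucc, ← lintegral_indicator (hS _),
      Measure.lintegral_bind (f i).aemeasurable
        ((measurable_hmmBack f g hS hT _).indicator (hS _)).aemeasurable]
    simp_rw [lintegral_indicator (hS i.succ)]
    rw [lintegral_withDensity_eq_lintegral_mul _ (Kernel.measurable_coe _ (hT _))
      (measurable_setLIntegral_kernel (f i) (hS _) (measurable_hmmBack f g hS hT _))]
    rfl

variable {f₀ f g}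
variable {q : Measure (∀ i, X i × Y i)}

theorem IsHMM.measure_rect (hq : IsHMM q f₀ f g) (hS : ∀ i, MeasurableSet (S i))
    (hT : ∀ i, MeasurableSet (T i)) (t : Fin (n+1)) :
    q (rect S T) = ∫⁻ x in S t, hmmBack f g S T t x ∂(hmmFwd f₀ f g S T t) := by
  rw [setLIntegral_hmmBack_hmmFwd f₀ f g hS hT t]
  exact hq S T hS hT

theorem measurableSet_update {Z : Fin (n+1) → Type*} [∀ i, MeasurableSpace (Z i)]
    {S : ∀ i, Set (Z i)} (hS : ∀ i, MeasurableSet (S i)) {t : Fin (n+1)} {C : Set (Z t)}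
    (hC : MeasurableSet C) (i : Fin (n+1)) : MeasurableSet (Function.update S t C i) := by
  by_cases h : i = t
  · subst h; simpa
  · simpa [h] using hS i

theorem IsHMM.setLIntegral_rect (hq : IsHMM q f₀ f g) (hS : ∀ i, MeasurableSet (S i))
    (hT : ∀ i, MeasurableSet (T i)) (t : Fin (n+1)) {φ : X t → ℝ≥0∞} (hφ : Measurable φ) :
    ∫⁻ ω in rect S T, φ (ω t).1 ∂q
      = ∫⁻ x in S t, hmmBack f g S T t x * φ x ∂(hmmFwd f₀ f g S T t) := by
  have hmap : (q.restrict (rect (Function.update S t Set.univ) T)).map (fun ω => (ω t).1)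
      = (hmmFwd f₀ f g S T t).withDensity (hmmBack f g S T t) := by
    ext C hC
    rw [Measure.map_apply (measurable_state t) hC,
      Measure.restrict_apply (measurable_state t hC), withDensity_apply _ hC]
    have hrect := rect_eq_state_inter (S := Function.update S t Set.univ)
      (S' := Function.update S t C) (T := T) (t := t) (fun i hi => by simp [hi]) (by simp)
    rw [Function.update_self] at hrect
    rw [← hrect, hq.measure_rect (measurableSet_update hS hC) hT t, Function.update_self,
      hmmBack_congr f g (S := Function.update S t C) (S' := S) (T' := T) t
        (fun i hi => by rw [Function.update_of_ne hi.ne']) (fun _ _ => rfl),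
      hmmFwd_congr f₀ f g (S := Function.update S t C) (S' := S) (T' := T) t
        (fun i hi => by rw [Function.update_of_ne hi.ne]) (fun _ _ => rfl)]
  rw [rect_eq_state_inter (S := Function.update S t Set.univ) (S' := S) (t := t)
    (fun i hi => by simp [hi]) (by simp), ← Measure.restrict_restrict (measurable_state t (hS t)),
    ← setLIntegral_map (hS t) hφ (measurable_state t), hmap,
    setLIntegral_withDensity_eq_setLIntegral_mul _ (measurable_hmmBack f g hS hT t) hφ (hS t)]
  rfl

theorem IsHMM.measure_rect_eq_obs [∀ t, IsMarkovKernel (g t)] (hq : IsHMM q f₀ f g)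
    (hS : ∀ i, MeasurableSet (S i)) (hT : ∀ i, MeasurableSet (T i)) (t : Fin (n+1)) :
    ∫⁻ ω in rect S (Function.update T t Set.univ), g t (ω t).1 (T t) ∂q = q (rect S T) := by
  rw [hq.setLIntegral_rect hS (measurableSet_update hT .univ) t (Kernel.measurable_coe _ (hT t)),
    hq.measure_rect hS hT t,
    hmmFwd_congr f₀ f g (S := S) (S' := S) (T := T) (T' := Function.update T t Set.univ) t
      (fun _ _ => rfl) (fun i hi => by rw [Function.update_of_ne hi.ne])]
  simp_rw [← hmmBack_eq_mul_update]

theorem IsHMM.measure_rect_eq_trans [∀ t, IsMarkovKernel (f t)] [∀ t, IsMarkovKernel (g t)]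
    (hq : IsHMM q f₀ f g) (hS : ∀ i, MeasurableSet (S i)) (hT : ∀ i, MeasurableSet (T i))
    (i : Fin n) (hSi : ∀ j, i.succ < j → S j = Set.univ)
    (hTi : ∀ j, i.succ ≤ j → T j = Set.univ) :
    ∫⁻ ω in rect (Function.update S i.succ Set.univ) T, f i (ω i.castSucc).1 (S i.succ) ∂q
      = q (rect S T) := by
  rw [hq.setLIntegral_rect (measurableSet_update hS .univ) hT i.castSucc
      (Kernel.measurable_coe _ (hS i.succ)),
    hq.measure_rect hS hT i.castSucc,
    hmmFwd_congr f₀ f g (S := S) (S' := Function.update S i.succ Set.univ) (T := T) (T' := T)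
      i.castSucc (fun j hj => by
        rw [Function.update_of_ne (hj.trans i.castSucc_lt_succ).ne]) (fun _ _ => rfl),
    Function.update_of_ne i.castSucc_lt_succ.ne]
  simp_rw [hmmBack_castSucc]
  rw [hmmBack_eq_one f g i.succ hSi hTi, hmmBack_eq_one f g i.succ
    (fun j hj => by rw [Function.update_of_ne hj.ne', hSi j hj]) hTi]
  simp
end

section
variable [∀ i, StandardBorelSpace (X i)] [∀ i, StandardBorelSpace (Y i)]
  {q : Measure (∀ i, X i × Y i)} [IsProbabilityMeasure q]

theorem condIndepCoords_state_iff (s t : Fin (n+1)) (B B' : Set (Fin (n+1))) :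
    CondIndepCoords q {s} ∅ {t} ∅ B B' ↔
      CondIndep (MeasurableSpace.comap (fun ω => (ω s).1) inferInstance)
        (MeasurableSpace.comap (fun ω => (ω t).1) inferInstance) (coordSigma B B')
        (measurable_state s).comap_le q := by
  simp only [CondIndepCoords, coordSigma_singleton_empty]

theorem condIndepCoords_obs_iff (s t : Fin (n+1)) (B B' : Set (Fin (n+1))) :
    CondIndepCoords q {s} ∅ ∅ {t} B B' ↔
      CondIndep (MeasurableSpace.comap (fun ω => (ω s).1) inferInstance)
        (MeasurableSpace.comap (fun ω => (ω t).2) inferInstance) (coordSigma B B')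
        (measurable_state s).comap_le q := by
  simp only [CondIndepCoords, coordSigma_singleton_empty, coordSigma_empty_singleton]

theorem IsHMM.condIndepCoords_state {f₀ : Measure (X 0)}
    {f : ∀ t : Fin n, Kernel (X t.castSucc) (X t.succ)} {g : ∀ t : Fin (n+1), Kernel (X t) (Y t)}
    [∀ t, IsMarkovKernel (f t)] [∀ t, IsMarkovKernel (g t)] (hq : IsHMM q f₀ f g) (i : Fin n) :
    CondIndepCoords q {i.castSucc} ∅ {i.succ} ∅ {j | j < i.castSucc} {j | j < i.succ} := by
  rw [condIndepCoords_state_iff, ← generateFrom_coordRects]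
  refine condIndep_of_setLIntegral_eq (measurable_state _) (measurable_state _) (f i)
    (fun _ => measurableSet_of_mem_coordRects) (isPiSystem_coordRects _ _)
    (univ_mem_coordRects _ _) ?_
  rintro C A _ hC hA ⟨S, T, hS, hT, hSu, hTu, rfl⟩
  have hlt := i.castSucc_lt_succ
  have hSu' : ∀ j, i.castSucc ≤ j → S j = Set.univ := fun j hj => hSu j (not_lt.2 hj)
  have hTu' : ∀ j, i.succ ≤ j → T j = Set.univ := fun j hj => hTu j (not_lt.2 hj)
  have hC' : rect (Function.update S i.castSucc C) T
      = (fun ω => (ω i.castSucc).1) ⁻¹' C ∩ rect S T := by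
    rw [rect_eq_state_inter (S := S) (t := i.castSucc) (fun j hj => by simp [hj])
      (hSu' _ le_rfl), Function.update_self]
  have hA' : rect (Function.update (Function.update S i.castSucc C) i.succ A) T
      = (fun ω => (ω i.succ).1) ⁻¹' A ∩ rect (Function.update S i.castSucc C) T := by
    rw [rect_eq_state_inter (S := Function.update S i.castSucc C) (t := i.succ)
      (fun j hj => by simp [hj]) (by rw [Function.update_of_ne hlt.ne', hSu' _ hlt.le]),
      Function.update_self]
  have key := hq.measure_rect_eq_trans
    (measurableSet_update (measurableSet_update hS hC) hA (t := i.succ)) hT i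
    (fun j hj => by
      rw [Function.update_of_ne hj.ne', Function.update_of_ne (hlt.trans hj).ne',
        hSu' j (hlt.trans hj).le]) hTu'
  have hupd : Function.update (Function.update S i.castSucc C) i.succ Set.univ
      = Function.update S i.castSucc C :=
    Function.update_eq_self_iff.2 (by rw [Function.update_of_ne hlt.ne', hSu' _ hlt.le])
  rw [Function.update_idem, hupd, Function.update_self, hA', hC'] at key
  rw [key, Set.inter_left_comm]

theorem IsHMM.condIndepCoords_obs {f₀ : Measure (X 0)}
    {f : ∀ t : Fin n, Kernel (X t.castSucc) (X t.succ)} {g : ∀ t : Fin (n+1), Kernel (X t) (Y t)}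
    [∀ t, IsMarkovKernel (g t)] (hq : IsHMM q f₀ f g) (t : Fin (n+1)) :
    CondIndepCoords q {t} ∅ ∅ {t} {i | i ≠ t} {j | j ≠ t} := by
  rw [condIndepCoords_obs_iff, ← generateFrom_coordRects]
  refine condIndep_of_setLIntegral_eq (measurable_state _) (measurable_obs _) (g t)
    (fun _ => measurableSet_of_mem_coordRects) (isPiSystem_coordRects _ _)
    (univ_mem_coordRects _ _) ?_
  rintro C A _ hC hA ⟨S, T, hS, hT, hSu, hTu, rfl⟩
  have hSt : S t = Set.univ := hSu t (by simp)
  have hTt : T t = Set.univ := hTu t (by simp)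
  have hC' : rect (Function.update S t C) T = (fun ω => (ω t).1) ⁻¹' C ∩ rect S T := by
    rw [rect_eq_state_inter (S := S) (t := t) (fun j hj => by simp [hj]) hSt,
      Function.update_self]
  have hA' : rect (Function.update S t C) (Function.update T t A)
      = (fun ω => (ω t).2) ⁻¹' A ∩ rect (Function.update S t C) T := by
    rw [rect_eq_obs_inter (T := T) (t := t) (fun j hj => by simp [hj]) hTt,
      Function.update_self]
  have key := hq.measure_rect_eq_obs (measurableSet_update hS hC (t := t))
    (measurableSet_update hT hA (t := t)) t
  have hupd : Function.update T t Set.univ = T :=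
    Function.update_eq_self_iff.2 hTt.symm
  rw [Function.update_idem, hupd, Function.update_self, hA', hC'] at key
  rw [key, Set.inter_left_comm]

/-- The constraints of `S` at the times before `t`. -/
def past {Z : Fin (n+1) → Type*} (S : ∀ i, Set (Z i)) (t i : Fin (n+1)) : Set (Z i) :=
  if i < t then S i else Set.univ

theorem past_of_lt {Z : Fin (n+1) → Type*} (S : ∀ i, Set (Z i)) {t i : Fin (n+1)} (h : i < t) :
    past S t i = S i :=
  if_pos h

theorem past_of_le {Z : Fin (n+1) → Type*} (S : ∀ i, Set (Z i)) {t i : Fin (n+1)} (h : t ≤ i) :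
    past S t i = Set.univ :=
  if_neg h.not_gt

theorem measurableSet_past {Z : Fin (n+1) → Type*} [∀ i, MeasurableSpace (Z i)]
    {S : ∀ i, Set (Z i)} (hS : ∀ i, MeasurableSet (S i)) (t i : Fin (n+1)) :
    MeasurableSet (past S t i) := by
  rcases lt_or_ge i t with h | h
  · simpa [past_of_lt S h] using hS i
  · simp [past_of_le S h]

theorem past_succ_eq_past_castSucc {Z : Fin (n+1) → Type*} (S : ∀ i, Set (Z i)) {i : Fin n}
    {j : Fin (n+1)} (h : j ≠ i.castSucc) : past S i.succ j = past S i.castSucc j := by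
  rcases lt_or_gt_of_ne h with h | h
  · rw [past_of_lt S h, past_of_lt S (h.trans i.castSucc_lt_succ)]
  · rw [past_of_le S h.le, past_of_le S (Fin.castSucc_lt_iff_succ_le.1 h)]

theorem setLIntegral_obs_of_condIndepCoords [∀ i, Nonempty (Y i)] {t : Fin (n+1)}
    (h : CondIndepCoords q {t} ∅ ∅ {t} {i | i ≠ t} {j | j ≠ t}) {S : ∀ i, Set (X i)}
    {T : ∀ i, Set (Y i)} (hS : ∀ i, MeasurableSet (S i)) (hT : ∀ i, MeasurableSet (T i))
    {ψ : X t → ℝ≥0∞} (hψ : Measurable ψ) :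
    ∫⁻ ω in (fun ω => (ω t).2) ⁻¹' (T t) ∩ rect (past S t) (past T t), ψ (ω t).1 ∂q
      = ∫⁻ ω in rect (past S t) (past T t),
          condDistrib (fun ω => (ω t).2) (fun ω => (ω t).1) q (ω t).1 (T t) * ψ (ω t).1 ∂q := by
  have hD : MeasurableSet[coordSigma {i | i ≠ t} {j | j ≠ t}] (rect (past S t) (past T t)) :=
    measurableSet_rect_coordSigma (measurableSet_past hS t) (measurableSet_past hT t)
      (fun i hi => past_of_le S (by simp_all)) (fun i hi => past_of_le T (by simp_all))
  have hind : Measurable ((T t).indicator (1 : Y t → ℝ≥0∞)) :=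
    measurable_one.indicator (hT t)
  have key := setLIntegral_eq_of_condIndep (measurable_state t) (measurable_obs t)
    (coordSigma_le _ _) ((condIndepCoords_obs_iff _ _ _ _).1 h) hD
    (φ := fun p => (T t).indicator 1 p.2 * ψ p.1)
    ((hind.comp measurable_snd).mul (hψ.comp measurable_fst))
  simp_rw [lintegral_mul_const _ hind, lintegral_indicator_one (hT t)] at key
  rw [← key, ← Measure.restrict_restrict (measurable_obs t (hT t)),
    ← lintegral_indicator (measurable_obs t (hT t))]
  refine lintegral_congr fun ω => ?_
  by_cases hω : (ω t).2 ∈ T t <;> simp [hω]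

theorem setLIntegral_state_of_condIndepCoords [∀ i, Nonempty (X i)] {i : Fin n}
    (h : CondIndepCoords q {i.castSucc} ∅ {i.succ} ∅ {j | j < i.castSucc} {j | j < i.succ})
    {S : ∀ i, Set (X i)} {T : ∀ i, Set (Y i)} (hS : ∀ i, MeasurableSet (S i))
    (hT : ∀ i, MeasurableSet (T i)) {ψ : X i.succ → ℝ≥0∞} (hψ : Measurable ψ) :
    ∫⁻ ω in rect (past S i.succ) (past T i.succ), ψ (ω i.succ).1 ∂q
      = ∫⁻ ω in rect (past S i.castSucc) (past T i.succ),
          (S i.castSucc).indicator (fun x => ∫⁻ x', ψ x'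
            ∂(condDistrib (fun ω => (ω i.succ).1) (fun ω => (ω i.castSucc).1) q x))
            (ω i.castSucc).1 ∂q := by
  have hD : MeasurableSet[coordSigma {j | j < i.castSucc} {j | j < i.succ}]
      (rect (past S i.castSucc) (past T i.succ)) :=
    measurableSet_rect_coordSigma (measurableSet_past hS _) (measurableSet_past hT _)
      (fun j hj => past_of_le S (by simpa using hj)) (fun j hj => past_of_le T (by simpa using hj))
  have hind : Measurable ((S i.castSucc).indicator (1 : X i.castSucc → ℝ≥0∞)) :=
    measurable_one.indicator (hS _)
  have key := setLIntegral_eq_of_condIndep (measurable_state i.castSucc) (measurable_state i.succ)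
    (coordSigma_le _ _) ((condIndepCoords_state_iff _ _ _ _).1 h) hD
    (φ := fun p => (S i.castSucc).indicator 1 p.1 * ψ p.2)
    ((hind.comp measurable_fst).mul (hψ.comp measurable_snd))
  simp_rw [lintegral_const_mul _ hψ] at key
  rw [rect_eq_state_inter (S := past S i.castSucc) (S' := past S i.succ) (t := i.castSucc)
      (fun j hj => past_succ_eq_past_castSucc S hj) (past_of_le S le_rfl),
    past_of_lt S i.castSucc_lt_succ, ← Measure.restrict_restrict (measurable_state _ (hS _)),
    ← lintegral_indicator (measurable_state _ (hS _))]
  calc _ = _ := lintegral_congr fun ω => ?_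
    _ = _ := key
    _ = _ := lintegral_congr fun ω => ?_
  all_goals by_cases hω : (ω i.castSucc).1 ∈ S i.castSucc <;> simp [hω]

theorem isHMM_of_condIndepCoords [∀ i, Nonempty (X i)] [∀ i, Nonempty (Y i)]
    (hstate : ∀ i : Fin n,
      CondIndepCoords q {i.castSucc} ∅ {i.succ} ∅ {j | j < i.castSucc} {j | j < i.succ})
    (hobs : ∀ t, CondIndepCoords q {t} ∅ ∅ {t} {i | i ≠ t} {j | j ≠ t}) :
    IsHMM q (q.map fun ω => (ω 0).1)
      (fun i => condDistrib (fun ω => (ω i.succ).1) (fun ω => (ω i.castSucc).1) q)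
      (fun t => condDistrib (fun ω => (ω t).2) (fun ω => (ω t).1) q) := by
  intro S T hS hT
  set f : ∀ i : Fin n, Kernel (X i.castSucc) (X i.succ) :=
    fun i => condDistrib (fun ω => (ω i.succ).1) (fun ω => (ω i.castSucc).1) q with hf
  set g : ∀ t : Fin (n+1), Kernel (X t) (Y t) :=
    fun t => condDistrib (fun ω => (ω t).2) (fun ω => (ω t).1) q with hg
  have hback := measurable_hmmBack f g hS hT
  have hstep : ∀ t, q (rect S T) = ∫⁻ ω in rect (past S t) (past T t),
      (S t).indicator (hmmBack f g S T t) (ω t).1 ∂q := by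
    intro t
    induction t using Fin.reverseInduction with
    | last =>
      have hlast : ∀ {i : Fin (n+1)}, i ≠ Fin.last n → i < Fin.last n :=
        fun h => lt_of_le_of_ne (Fin.le_last _) h
      have hrect : rect S T = (fun ω => (ω (Fin.last n)).1) ⁻¹' (S (Fin.last n)) ∩
          ((fun ω => (ω (Fin.last n)).2) ⁻¹' (T (Fin.last n)) ∩
            rect (past S (Fin.last n)) (past T (Fin.last n))) := by
        rw [rect_eq_state_inter (S := past S (Fin.last n)) (t := Fin.last n)
            (fun i hi => (past_of_lt S (hlast hi)).symm) (past_of_le S le_rfl),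
          rect_eq_obs_inter (T := past T (Fin.last n)) (t := Fin.last n)
            (fun i hi => (past_of_lt T (hlast hi)).symm) (past_of_le T le_rfl)]
      have key := setLIntegral_obs_of_condIndepCoords (hobs (Fin.last n)) hS hT
        (measurable_one.indicator (hS (Fin.last n)))
      rw [hrect, ← Measure.restrict_apply (measurable_state _ (hS _)),
        ← lintegral_indicator_one (measurable_state _ (hS _)), hmmBack_last]
      refine key.trans (lintegral_congr fun ω => ?_)
      by_cases hω : (ω (Fin.last n)).1 ∈ S (Fin.last n) <;> simp [hω, hg]
    | cast i ih =>
      rw [ih, setLIntegral_state_of_condIndepCoords (hstate i) hS hT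
          ((hback i.succ).indicator (hS i.succ)),
        rect_eq_obs_inter (T := past T i.castSucc) (T' := past T i.succ) (t := i.castSucc)
          (fun j hj => past_succ_eq_past_castSucc T hj) (past_of_le T le_rfl),
        past_of_lt T i.castSucc_lt_succ,
        setLIntegral_obs_of_condIndepCoords (hobs i.castSucc) hS hT
          (((hback i.succ).indicator (hS i.succ)).lintegral_kernel.indicator (hS _)),
        hmmBack_castSucc]
      refine lintegral_congr fun ω => ?_
      by_cases hω : (ω i.castSucc).1 ∈ S i.castSucc <;>
        simp [hω, hg, hf, lintegral_indicator (hS i.succ)]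
  have huniv : rect (past S 0) (past T 0) = Set.univ := by
    ext ω
    simp [mem_rect, past]
  refine (hstep 0).trans ?_
  rw [huniv, Measure.restrict_univ, ← lintegral_indicator (hS 0),
    lintegral_map ((hback 0).indicator (hS 0)) (measurable_state 0)]

theorem setOf_val_add_two_le (i : Fin n) :
    {j : Fin (n+1) | (j : ℕ) + 2 ≤ (i : ℕ) + 1} = {j | j < i.castSucc} := by
  ext j
  simp only [Set.mem_ofPred_eq, Fin.lt_def, Fin.val_castSucc]
  omega

theorem setOf_val_ne (t : Fin (n+1)) : {j : Fin (n+1) | (j : ℕ) ≠ t} = {j | j ≠ t} := by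
  ext j
  simp [Fin.ext_iff]

end

end

/-- **The local Markov property characterizes hidden Markov models**
(Proposition `MarkovProperties`, (ii) ⇔ (iv), instantiated in `BorelStoch`). -/
theorem localMarkov_iff_isHMM
    {X Y : Fin (n+1) → Type*} [∀ i, MeasurableSpace (X i)] [∀ i, MeasurableSpace (Y i)]
    [∀ i, StandardBorelSpace (X i)] [∀ i, StandardBorelSpace (Y i)]
    (q : Measure (∀ i, X i × Y i)) [IsProbabilityMeasure q] :
    ((∀ (t : ℕ) (ht1 : 1 ≤ t) (ht2 : t ≤ n),
        CondIndepCoords q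
          {(⟨t - 1, by omega⟩ : Fin (n+1))} ∅
          {(⟨t, by omega⟩ : Fin (n+1))} ∅
          {i : Fin (n+1) | (i : ℕ) + 2 ≤ t} {j : Fin (n+1) | (j : ℕ) < t}) ∧
      (∀ (t : ℕ) (ht : t ≤ n),
        CondIndepCoords q
          {(⟨t, by omega⟩ : Fin (n+1))} ∅
          ∅ {(⟨t, by omega⟩ : Fin (n+1))}
          {i : Fin (n+1) | (i : ℕ) ≠ t} {j : Fin (n+1) | (j : ℕ) ≠ t}))
    ↔ (∃ (f₀ : Measure (X 0)) (f : ∀ t : Fin n, Kernel (X t.castSucc) (X t.succ))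
          (g : ∀ t : Fin (n+1), Kernel (X t) (Y t)),
        IsProbabilityMeasure f₀ ∧ (∀ t, IsMarkovKernel (f t)) ∧
          (∀ t, IsMarkovKernel (g t)) ∧ IsHMM q f₀ f g) := by
  have hΩ : Nonempty (∀ i, X i × Y i) := nonempty_of_isProbabilityMeasure q
  have : ∀ i, Nonempty (X i) := fun i => hΩ.map fun ω => (ω i).1
  have : ∀ i, Nonempty (Y i) := fun i => hΩ.map fun ω => (ω i).2
  constructor
  · rintro ⟨hstate, hobs⟩
    refine ⟨_, _, _, Measure.isProbabilityMeasure_map (measurable_state 0).aemeasurable,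
      fun _ => inferInstance, fun _ => inferInstance,
      isHMM_of_condIndepCoords (fun i => ?_) (fun t => ?_)⟩
    · rw [← setOf_val_add_two_le i]
      exact hstate (i + 1) (by omega) (by omega)
    · rw [← setOf_val_ne t]
      exact hobs t (by omega)
  · rintro ⟨f₀, f, g, -, hf, hg, hq⟩
    refine ⟨fun t ht1 ht2 => ?_, fun t ht => ?_⟩
    · obtain ⟨k, rfl⟩ : ∃ k, t = k + 1 := ⟨t - 1, by omega⟩
      have h := hq.condIndepCoords_state ⟨k, by omega⟩
      rw [← setOf_val_add_two_le ⟨k, by omega⟩] at h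
      exact h
    · have h := hq.condIndepCoords_obs ⟨t, by omega⟩
      rw [← setOf_val_ne ⟨t, by omega⟩] at h
      exact h

end HMMStmt
end
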